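/- Let G be a 3-edge-connected cubic graph on n vertices. Then the number of distinct 3-edge-cuts of G is at most 2n − 3. -/

import Mathlib

open SimpleGraph Set

/-- The edge cut `δ(A)`: edges of `G` with exactly one endpoint in `A`. -/
def edgeCut {V : Type*} (G : SimpleGraph V) (A : Set V) : Set (Sym2 V) :=
  {e | e ∈ G.edgeSet ∧ ∃ u v, e = s(u, v) ∧ u ∈ A ∧ v ∉ A}

/-- A graph is cubic if every vertex has exactly three neighbours. -/
def IsCubic {V : Type*} (G : SimpleGraph V) : Prop :=
  ∀ v : V, (G.neighborSet v).ncard = 3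

/-- A graph is bridgeless if it has no bridge. -/
def Bridgeless {V : Type*} (G : SimpleGraph V) : Prop :=
  ∀ e : Sym2 V, ¬ G.IsBridge e

/-- A connected graph is 3-edge-connected if it stays connected after
removing fewer than three edges. -/
def ThreeEdgeConnected {V : Type*} (G : SimpleGraph V) : Prop :=
  G.Connected ∧ ∀ S : Set (Sym2 V), S.ncard < 3 → (G.deleteEdges S).Connected

/-- A perfect matching viewed as a set of edges: pairwise disjoint edges of `G`
covering every vertex exactly once. -/
def IsPerfectMatchingSet {V : Type*} (G : SimpleGraph V) (M : Set (Sym2 V)) : Prop :=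
  M ⊆ G.edgeSet ∧ ∀ v : V, ∃! e, e ∈ M ∧ v ∈ e

/-- A laminar family of nonempty subsets of a nonempty finite set `S` has fewer than `2 * #S`
members. -/
theorem Finset.card_lt_two_mul_of_laminar {V : Type*} [DecidableEq V] (S : Finset V)
    (hS : S.Nonempty) (F : Finset (Finset V)) (hsub : ∀ A ∈ F, A ⊆ S)
    (hne : ∀ A ∈ F, A.Nonempty)
    (hlam : ∀ A ∈ F, ∀ B ∈ F, Disjoint A B ∨ A ⊆ B ∨ B ⊆ A) :
    F.card < 2 * S.card := by
  induction S using Finset.strongInduction generalizing F with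
  | H S ih =>
    have hSpos := hS.card_pos
    by_cases hF : (F.erase S).Nonempty
    · obtain ⟨M, hM, hmax⟩ := (F.erase S).exists_maximal hF
      obtain ⟨hMS, hMF⟩ := Finset.mem_erase.1 hM
      have hMsub : M ⊂ S := (hsub M hMF).ssubset_of_ne hMS
      have hinside := ih M hMsub (hne M hMF) {A ∈ F | A ⊆ M} (by simp)
        (fun A hA => hne A (Finset.mem_filter.1 hA).1)
        (fun A hA B hB => hlam A (Finset.mem_filter.1 hA).1 B (Finset.mem_filter.1 hB).1)
      have houtside := ih (S \ M) (Finset.sdiff_ssubset hMsub.1 (hne M hMF))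
        (Finset.sdiff_nonempty.2 hMsub.2) {A ∈ F | A ⊆ S \ M} (by simp)
        (fun A hA => hne A (Finset.mem_filter.1 hA).1)
        (fun A hA B hB => hlam A (Finset.mem_filter.1 hA).1 B (Finset.mem_filter.1 hB).1)
      have hcover : F ⊆ insert S ({A ∈ F | A ⊆ M} ∪ {A ∈ F | A ⊆ S \ M}) := by
        intro A hA
        by_cases hAS : A = S
        · simp [hAS]
        · have hA' : A ∈ F.erase S := Finset.mem_erase.2 ⟨hAS, hA⟩
          rcases hlam A hA M hMF with h | h | h
          · simp [hA, Finset.subset_sdiff, hsub A hA, h]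
          · simp [hA, h]
          · have : A ⊆ M := hmax hA' h
            simp [hA, this]
      have h1 := Finset.card_le_card hcover
      have h2 := Finset.card_insert_le S ({A ∈ F | A ⊆ M} ∪ {A ∈ F | A ⊆ S \ M})
      have h3 := Finset.card_union_le {A ∈ F | A ⊆ M} {A ∈ F | A ⊆ S \ M}
      have h4 := Finset.card_sdiff_add_card_eq_card hMsub.1
      omega
    · have h : F ⊆ {S} := by
        intro A hA
        by_contra hAS
        exact hF ⟨A, Finset.mem_erase.2 ⟨by simpa using hAS, hA⟩⟩
      have := Finset.card_le_card h
      rw [Finset.card_singleton] at this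
      omega

theorem edgeCut_compl {V : Type*} (G : SimpleGraph V) (A : Set V) :
    edgeCut G Aᶜ = edgeCut G A := by
  ext e
  constructor <;> rintro ⟨he, u, v, rfl, hu, hv⟩ <;>
    exact ⟨he, v, u, Sym2.eq_swap, by simpa using hv, by simpa using hu⟩

/-- In a 3-edge-connected graph every edge cut has at least three edges. -/
theorem ThreeEdgeConnected.three_le_ncard_edgeCut {V : Type*} {G : SimpleGraph V}
    (h : ThreeEdgeConnected G) {A : Set V} (hA : A.Nonempty) (hA' : A ≠ Set.univ) :
    3 ≤ (edgeCut G A).ncard := by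
  by_contra! hlt
  obtain ⟨a, ha⟩ := hA
  obtain ⟨b, hb⟩ := (Set.ne_univ_iff_exists_notMem A).1 hA'
  obtain ⟨p⟩ := (h.2 _ hlt).preconnected a b
  obtain ⟨d, -, hd, hd'⟩ := p.exists_boundary_dart A ha hb
  have hadj := d.adj
  rw [SimpleGraph.deleteEdges_adj] at hadj
  exact hadj.2 ⟨hadj.1, d.fst, d.snd, rfl, hd, hd'⟩

open Classical in
/-- The number of edges from `A` to `B`, for disjoint `A` and `B`. -/
noncomputable def SimpleGraph.crossCount {V : Type*} (G : SimpleGraph V) (A B : Finset V) : ℕ :=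
  ∑ u ∈ A, ∑ v ∈ B, if G.Adj u v then 1 else 0

section

variable {V : Type*} (G : SimpleGraph V)

theorem SimpleGraph.crossCount_comm (A B : Finset V) :
    G.crossCount A B = G.crossCount B A := by
  unfold crossCount
  rw [Finset.sum_comm]
  refine Finset.sum_congr rfl fun u _ => Finset.sum_congr rfl fun v _ => ?_
  rw [G.adj_comm]

variable [DecidableEq V]

theorem SimpleGraph.crossCount_union_left {A B : Finset V} (h : Disjoint A B) (C : Finset V) :
    G.crossCount (A ∪ B) C = G.crossCount A C + G.crossCount B C :=
  Finset.sum_union h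

theorem SimpleGraph.crossCount_union_right (C : Finset V) {A B : Finset V} (h : Disjoint A B) :
    G.crossCount C (A ∪ B) = G.crossCount C A + G.crossCount C B := by
  rw [crossCount_comm, crossCount_union_left G h, crossCount_comm, G.crossCount_comm B]

variable [Fintype V]

theorem ncard_edgeCut_eq_crossCount (A : Finset V) :
    (edgeCut G A).ncard = G.crossCount A Aᶜ := by
  classical
  have himage : edgeCut G A =
      (fun p : V × V => s(p.1, p.2)) '' ↑{p ∈ A ×ˢ Aᶜ | G.Adj p.1 p.2} := by
    ext e
    constructor
    · rintro ⟨he, u, v, rfl, hu, hv⟩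
      exact ⟨(u, v), by simpa using ⟨⟨hu, hv⟩, he⟩, rfl⟩
    · rintro ⟨⟨u, v⟩, hp, rfl⟩
      simp only [Finset.coe_filter, Finset.mem_product, Finset.mem_compl, Set.mem_ofPred_eq] at hp
      exact ⟨hp.2, u, v, rfl, hp.1.1, hp.1.2⟩
  rw [himage, Set.InjOn.ncard_image, Set.ncard_coe_finset, Finset.card_filter,
    Finset.sum_product]
  · unfold SimpleGraph.crossCount
    congr!
  · rintro ⟨u, v⟩ hp ⟨u', v'⟩ hq h
    simp only [Finset.coe_filter, Finset.mem_product, Finset.mem_compl, Set.mem_ofPred_eq] at hp hq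
    rcases Sym2.eq_iff.1 h with ⟨rfl, rfl⟩ | ⟨rfl, rfl⟩
    · rfl
    · exact absurd hp.1.1 hq.1.2

/-- The boundary of a nontrivial vertex set of a 3-edge-connected graph has size at least 3. -/
theorem ThreeEdgeConnected.three_le_crossCount {G : SimpleGraph V} (h : ThreeEdgeConnected G)
    {X : Finset V} (hX : X.Nonempty) (hX' : Xᶜ.Nonempty) : 3 ≤ G.crossCount X Xᶜ := by
  rw [← ncard_edgeCut_eq_crossCount]
  refine h.three_le_ncard_edgeCut (by simpa using hX) ?_
  obtain ⟨x, hx⟩ := hX'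
  exact (Set.ne_univ_iff_exists_notMem _).2 ⟨x, by simpa using hx⟩

/-- Two 3-edge-cuts of a 3-edge-connected graph do not cross. -/
theorem ThreeEdgeConnected.not_crossing {G : SimpleGraph V} (h : ThreeEdgeConnected G)
    {A B : Finset V} (hA : (edgeCut G A).ncard = 3) (hB : (edgeCut G B).ncard = 3)
    (hAB : (A ∩ B).Nonempty) (hAdB : (A \ B).Nonempty) (hBdA : (B \ A).Nonempty) :
    A ∪ B = Finset.univ := by
  by_contra hU
  rw [ncard_edgeCut_eq_crossCount] at hA hB
  obtain ⟨P, hP⟩ : ∃ P, A ∩ B = P := ⟨_, rfl⟩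
  obtain ⟨Q, hQ⟩ : ∃ Q, A \ B = Q := ⟨_, rfl⟩
  obtain ⟨R, hR⟩ : ∃ R, B \ A = R := ⟨_, rfl⟩
  obtain ⟨T, hT⟩ : ∃ T, (A ∪ B)ᶜ = T := ⟨_, rfl⟩
  have hTne : T.Nonempty := by
    rw [← hT, Finset.nonempty_iff_ne_empty, Ne, Finset.compl_eq_empty_iff]
    exact hU
  rw [hP] at hAB
  rw [hQ] at hAdB
  rw [hR] at hBdA
  have dPQ : Disjoint P Q := by rw [Finset.disjoint_left]; grind [Finset.mem_compl]
  have dPR : Disjoint P R := by rw [Finset.disjoint_left]; grind [Finset.mem_compl]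
  have dRT : Disjoint R T := by rw [Finset.disjoint_left]; grind [Finset.mem_compl]
  have dQT : Disjoint Q T := by rw [Finset.disjoint_left]; grind [Finset.mem_compl]
  have dQRT : Disjoint Q (R ∪ T) := by rw [Finset.disjoint_left]; grind [Finset.mem_compl]
  have dPRT : Disjoint P (R ∪ T) := by rw [Finset.disjoint_left]; grind [Finset.mem_compl]
  have dPQT : Disjoint P (Q ∪ T) := by rw [Finset.disjoint_left]; grind [Finset.mem_compl]
  have dPQR : Disjoint P (Q ∪ R) := by rw [Finset.disjoint_left]; grind [Finset.mem_compl]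
  have dQR : Disjoint Q R := by rw [Finset.disjoint_left]; grind [Finset.mem_compl]
  have eA : A = P ∪ Q := by grind [Finset.mem_compl]
  have eB : B = P ∪ R := by grind [Finset.mem_compl]
  have cA : Aᶜ = R ∪ T := by ext; grind [Finset.mem_compl]
  have cB : Bᶜ = Q ∪ T := by ext; grind [Finset.mem_compl]
  have cP : Pᶜ = Q ∪ (R ∪ T) := by ext; grind [Finset.mem_compl]
  have cQ : Qᶜ = P ∪ (R ∪ T) := by ext; grind [Finset.mem_compl]
  have cR : Rᶜ = P ∪ (Q ∪ T) := by ext; grind [Finset.mem_compl]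
  have cT : Tᶜ = P ∪ (Q ∪ R) := by ext; grind [Finset.mem_compl]
  have kP := h.three_le_crossCount hAB (by rw [cP]; exact hAdB.mono Finset.subset_union_left)
  have kQ := h.three_le_crossCount hAdB (by rw [cQ]; exact hAB.mono Finset.subset_union_left)
  have kR := h.three_le_crossCount hBdA (by rw [cR]; exact hAB.mono Finset.subset_union_left)
  have kT := h.three_le_crossCount hTne (by rw [cT]; exact hAB.mono Finset.subset_union_left)
  rw [cA, eA, G.crossCount_union_left dPQ, G.crossCount_union_right _ dRT,
    G.crossCount_union_right _ dRT] at hA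
  rw [cB, eB, G.crossCount_union_left dPR, G.crossCount_union_right _ dQT,
    G.crossCount_union_right _ dQT] at hB
  rw [cP, G.crossCount_union_right _ dQRT, G.crossCount_union_right _ dRT] at kP
  rw [cQ, G.crossCount_union_right _ dPRT, G.crossCount_union_right _ dRT] at kQ
  rw [cR, G.crossCount_union_right _ dPQT, G.crossCount_union_right _ dQT] at kR
  rw [cT, G.crossCount_union_right _ dPQR, G.crossCount_union_right _ dQR] at kT
  have sQP := G.crossCount_comm Q P
  have sRP := G.crossCount_comm R P
  have sTP := G.crossCount_comm T P
  have sRQ := G.crossCount_comm R Q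
  have sTQ := G.crossCount_comm T Q
  have sTR := G.crossCount_comm T R
  omega

end

theorem stmt_6 {V : Type*} [Fintype V] (G : SimpleGraph V)
    (h3ec : ThreeEdgeConnected G) (hcubic : IsCubic G) :
    {C : Set (Sym2 V) | ∃ A : Set V, A.Nonempty ∧ A ≠ Set.univ ∧
        (edgeCut G A).ncard = 3 ∧ C = edgeCut G A}.ncard ≤ 2 * Fintype.card V - 3 := by
  classical
  obtain ⟨r⟩ := h3ec.1.nonempty
  let F : Finset (Finset V) := {A | A.Nonempty ∧ r ∉ A ∧ (edgeCut G A).ncard = 3}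
  have hF (A : Finset V) : A ∈ F ↔ A.Nonempty ∧ r ∉ A ∧ (edgeCut G A).ncard = 3 := by
    simp [F]
  have hcover : {C : Set (Sym2 V) | ∃ A : Set V, A.Nonempty ∧ A ≠ Set.univ ∧
      (edgeCut G A).ncard = 3 ∧ C = edgeCut G A} ⊆
      (fun A : Finset V => edgeCut G (A : Set V)) '' (F : Set (Finset V)) := by
    rintro C ⟨A, hne, huniv, hcard, rfl⟩
    by_cases hr : r ∈ A
    · refine ⟨Aᶜ.toFinset, ?_, by simp [edgeCut_compl]⟩
      rw [Finset.mem_coe, hF, Set.coe_toFinset, edgeCut_compl, Set.toFinset_nonempty,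
        Set.nonempty_compl]
      exact ⟨huniv, by simpa using hr, hcard⟩
    · refine ⟨A.toFinset, ?_, by simp⟩
      rw [Finset.mem_coe, hF, Set.coe_toFinset, Set.toFinset_nonempty]
      exact ⟨hne, by simpa using hr, hcard⟩
  have hle : _ ≤ F.card := (Set.ncard_le_ncard hcover).trans
    ((Set.ncard_image_le F.finite_toSet).trans (Set.ncard_coe_finset F).le)
  have hlam : ∀ A ∈ F, ∀ B ∈ F, Disjoint A B ∨ A ⊆ B ∨ B ⊆ A := by
    intro A hA B hB
    rw [hF] at hA hB
    by_contra! hcross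
    obtain ⟨h1, h2, h3⟩ := hcross
    have := h3ec.not_crossing hA.2.2 hB.2.2 (Finset.not_disjoint_iff_nonempty_inter.1 h1)
      (Finset.sdiff_nonempty.2 h2) (Finset.sdiff_nonempty.2 h3)
    have hr : r ∈ A ∪ B := this ▸ Finset.mem_univ r
    simp [hA.2.1, hB.2.1] at hr
  have hS : (Finset.univ.erase r).Nonempty := by
    have hpos : 0 < (G.neighborSet r).ncard := by rw [hcubic r]; norm_num
    obtain ⟨v, hv⟩ := Set.nonempty_of_ncard_ne_zero hpos.ne'
    exact ⟨v, Finset.mem_erase.2 ⟨(G.ne_of_adj hv).symm, Finset.mem_univ v⟩⟩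
  have hbound := Finset.card_lt_two_mul_of_laminar _ hS F
    (fun A hA v hv => Finset.mem_erase.2
      ⟨fun hvr => ((hF A).1 hA).2.1 (hvr ▸ hv), Finset.mem_univ v⟩)
    (fun A hA => ((hF A).1 hA).1) hlam
  rw [Finset.card_erase_of_mem (Finset.mem_univ r), Finset.card_univ] at hbound
  omega
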